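/- Let $X$ be an $n$-dimensional Gaussian vector with covariance $K$, let $I_1, I_2 \subseteq \{1,\ldots,n\}$ satisfy $K(i,j) \ge 0$ for all $i \in I_1, j \in I_2$, and let $A_1 \in \sigma(I_1)$, $A_2 \in \sigma(I_2)$ be increasing events. Then for every $\varepsilon > 0$, $\Pr[X \in A_1 \cap A_2] - \Pr[X + \varepsilon\mathbf{1} \in A_1]\Pr[X + \varepsilon\mathbf{1} \in A_2] \le \|K_{I_1,I_2}\|_\infty / \varepsilon^2$, where $\|K_{I_1,I_2}\|_\infty = \max_{i \in I_1, j \in I_2} |K(i,j)|$. -/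

import Mathlib

open MeasureTheory ProbabilityTheory

/-- An event `A ⊆ ℝⁿ` is increasing if it is closed under adding coordinatewise
nonnegative vectors. -/
def IncreasingEvent {n : ℕ} (A : Set (Fin n → ℝ)) : Prop :=
  ∀ x ∈ A, ∀ v : Fin n → ℝ, (∀ i, 0 ≤ v i) → x + v ∈ A

/-- An event `A` is supported on `I` if membership is unchanged by modifying
coordinates outside `I`. -/
def SupportedOn {n : ℕ} (A : Set (Fin n → ℝ)) (I : Set (Fin n)) : Prop :=
  ∀ x y : Fin n → ℝ, (∀ i ∈ I, x i = y i) → (x ∈ A ↔ y ∈ A)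

/-- `X` is a Gaussian vector: every linear combination of coordinates is Gaussian. -/
def IsGaussianVector {Ω : Type*} [MeasureSpace Ω] {n : ℕ} (X : Ω → Fin n → ℝ) : Prop :=
  ∀ a : Fin n → ℝ, ∃ (m : ℝ) (v : NNReal),
    Measure.map (fun ω => ∑ i, a i * X ω i) ℙ = gaussianReal m v

/-- The threshold `T_A(x) = sup {u : x - u·𝟙 ∈ A}` of an increasing event. -/
noncomputable def thr {n : ℕ} (A : Set (Fin n → ℝ)) (x : Fin n → ℝ) : ℝ :=
  sSup {u : ℝ | (fun i => x i - u) ∈ A}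

/-- `‖K_{I₁,I₂}‖_∞ = max_{i ∈ I₁, j ∈ I₂} |K(i,j)|`. -/
noncomputable def kNorm {n : ℕ} (K : Fin n → Fin n → ℝ) (I1 I2 : Finset (Fin n)) : ℝ :=
  sSup {r : ℝ | ∃ i ∈ I1, ∃ j ∈ I2, r = |K i j|}


/-- A bounded function with a nonnegative approximate gradient `p` supported on `I`, of
`ℓ¹`-norm at most `L`, and with quadratic Taylor remainder controlled by `M`. -/
structure HasMonotoneGradient {n : ℕ} (I : Finset (Fin n)) (L M : ℝ) (f : (Fin n → ℝ) → ℝ)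
    (p : Fin n → (Fin n → ℝ) → ℝ) : Prop where
  measurable : Measurable f
  abs_le_one : ∀ x, |f x| ≤ 1
  measurable_grad : ∀ i, Measurable (p i)
  grad_nonneg : ∀ i x, 0 ≤ p i x
  sum_grad_le : ∀ x, ∑ i, p i x ≤ L
  grad_eq_zero : ∀ i ∉ I, ∀ x, p i x = 0
  taylor : ∀ x y, |f y - f x - ∑ i, p i x * (y i - x i)| ≤ M * ‖y - x‖ ^ 2

namespace HasMonotoneGradient

variable {n : ℕ} {I : Finset (Fin n)} {L M : ℝ} {f : (Fin n → ℝ) → ℝ}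
  {p : Fin n → (Fin n → ℝ) → ℝ}

lemma grad_le (hf : HasMonotoneGradient I L M f p) (i : Fin n) (x : Fin n → ℝ) : p i x ≤ L :=
  (Finset.single_le_sum (fun j _ => hf.grad_nonneg j x) (Finset.mem_univ i)).trans
    (hf.sum_grad_le x)

lemma nonneg (hf : HasMonotoneGradient I L M f p) : 0 ≤ L :=
  (Finset.sum_nonneg fun j _ => hf.grad_nonneg j 0).trans (hf.sum_grad_le 0)

lemma mono {M' : ℝ} (hf : HasMonotoneGradient I L M f p) (h : M ≤ M') :
    HasMonotoneGradient I L M' f p :=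
  { hf with taylor := fun x y => (hf.taylor x y).trans (by gcongr) }

lemma translate (hf : HasMonotoneGradient I L M f p) (a : Fin n → ℝ) :
    HasMonotoneGradient I L M (fun x => f (a + x)) (fun i x => p i (a + x)) where
  measurable := hf.measurable.comp (measurable_const_add a)
  abs_le_one x := hf.abs_le_one _
  measurable_grad i := (hf.measurable_grad i).comp (measurable_const_add a)
  grad_nonneg i x := hf.grad_nonneg i _
  sum_grad_le x := hf.sum_grad_le _
  grad_eq_zero i hi x := hf.grad_eq_zero i hi _
  taylor x y := by simpa using hf.taylor (a + x) (a + y)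

lemma integrable_comp {Ω : Type*} [MeasurableSpace Ω] {μ : Measure Ω} [IsFiniteMeasure μ]
    (hf : HasMonotoneGradient I L M f p) {u : Ω → Fin n → ℝ} (hu : Measurable u) :
    Integrable (fun ω => f (u ω)) μ :=
  Integrable.of_bound (hf.measurable.comp hu).aestronglyMeasurable 1
    (ae_of_all _ fun _ => hf.abs_le_one _)

lemma integrable_grad_comp {Ω : Type*} [MeasurableSpace Ω] {μ : Measure Ω} [IsFiniteMeasure μ]
    (hf : HasMonotoneGradient I L M f p) {u : Ω → Fin n → ℝ} (hu : Measurable u) (i : Fin n) :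
    Integrable (fun ω => p i (u ω)) μ :=
  Integrable.of_bound ((hf.measurable_grad i).comp hu).aestronglyMeasurable L
    (ae_of_all _ fun _ => by
      rw [Real.norm_eq_abs, abs_of_nonneg (hf.grad_nonneg _ _)]; exact hf.grad_le _ _)

lemma average (hf : HasMonotoneGradient I L M f p) (μ : Measure (Fin n → ℝ))
    [IsProbabilityMeasure μ] (s : ℝ) :
    HasMonotoneGradient I L M (fun x => ∫ y, f (x + s • y) ∂μ)
      (fun i x => ∫ y, p i (x + s • y) ∂μ) where
  measurable := by
    have h : Measurable (Function.uncurry fun x y : Fin n → ℝ => f (x + s • y)) :=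
      hf.measurable.comp (by fun_prop)
    exact h.stronglyMeasurable.integral_prod_right.measurable
  abs_le_one x := by
    simpa using norm_integral_le_of_norm_le_const (μ := μ) (f := fun y => f (x + s • y))
      (ae_of_all _ fun y => hf.abs_le_one (x + s • y))
  measurable_grad i := by
    have h : Measurable (Function.uncurry fun x y : Fin n → ℝ => p i (x + s • y)) :=
      (hf.measurable_grad i).comp (by fun_prop)
    exact h.stronglyMeasurable.integral_prod_right.measurable
  grad_nonneg i x := integral_nonneg fun y => hf.grad_nonneg i _
  sum_grad_le x := by
    rw [← integral_finsetSum _ fun i _ => hf.integrable_grad_comp (by fun_prop) i]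
    have := integral_mono (μ := μ)
      (integrable_finsetSum _ fun i _ => hf.integrable_grad_comp (by fun_prop) i)
      (integrable_const L) (fun y => hf.sum_grad_le (x + s • y))
    simpa using this
  grad_eq_zero i hi x := by simp [hf.grad_eq_zero i hi]
  taylor x y := by
    have hp (i : Fin n) := hf.integrable_grad_comp (μ := μ)
      (u := fun z => x + s • z) (by fun_prop) i
    have hx := hf.integrable_comp (μ := μ) (u := fun z => x + s • z) (by fun_prop)
    have hy := hf.integrable_comp (μ := μ) (u := fun z => y + s • z) (by fun_prop)
    have h : (∫ z, f (y + s • z) ∂μ) - (∫ z, f (x + s • z) ∂μ)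
        - ∑ i, (∫ z, p i (x + s • z) ∂μ) * (y i - x i)
        = ∫ z, (f (y + s • z) - f (x + s • z) - ∑ i, p i (x + s • z) * (y i - x i)) ∂μ := by
      have hyx : Integrable (fun z => f (y + s • z) - f (x + s • z)) μ := hy.sub hx
      rw [integral_sub hyx (integrable_finsetSum _ fun i _ => (hp i).mul_const _),
        integral_sub hy hx, integral_finsetSum _ fun i _ => (hp i).mul_const _]
      simp_rw [integral_mul_const]
    rw [h]
    have := norm_integral_le_of_norm_le_const (μ := μ)
      (f := fun z => f (y + s • z) - f (x + s • z) - ∑ i, p i (x + s • z) * (y i - x i))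
      (C := M * ‖y - x‖ ^ 2)
      (ae_of_all _ fun z => by simpa using hf.taylor (x + s • z) (y + s • z))
    simpa using this

end HasMonotoneGradient

/-- The covariance of `f` and `g` under the law `μ` rescaled by `s`. -/
noncomputable def scaledCov {n : ℕ} (μ : Measure (Fin n → ℝ)) (s : ℝ)
    (f g : (Fin n → ℝ) → ℝ) : ℝ :=
  ∫ x, f (s • x) * g (s • x) ∂μ - (∫ x, f (s • x) ∂μ) * ∫ x, g (s • x) ∂μ

lemma scaledCov_mul_le {n : ℕ} {I J : Finset (Fin n)} {L M : ℝ} {μ : Measure (Fin n → ℝ)}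
    [IsProbabilityMeasure μ] {c : ℝ}
    (hμ : (μ.prod μ).map (fun z => c • (z.1 + z.2)) = μ) {s B : ℝ}
    (hB : ∀ f g p q, HasMonotoneGradient I L M f p → HasMonotoneGradient J L M g q →
      scaledCov μ (s * c) f g ≤ B)
    {f g : (Fin n → ℝ) → ℝ} {p q : Fin n → (Fin n → ℝ) → ℝ}
    (hf : HasMonotoneGradient I L M f p) (hg : HasMonotoneGradient J L M g q) :
    scaledCov μ s f g ≤ 2 * B := by
  have key (φ : (Fin n → ℝ) → ℝ) (hφ : Measurable φ) (hb : ∀ x, |φ x| ≤ 1) :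
      ∫ x, φ (s • x) ∂μ = ∫ x, ∫ y, φ ((s * c) • x + (s * c) • y) ∂μ ∂μ := by
    have hφs : Measurable fun x => φ (s • x) := hφ.comp (measurable_const_smul s)
    have hm : Measurable fun z : (Fin n → ℝ) × (Fin n → ℝ) => c • (z.1 + z.2) := by fun_prop
    conv_lhs => rw [← hμ]
    rw [integral_map hm.aemeasurable hφs.aestronglyMeasurable, integral_prod]
    · simp [smul_smul, smul_add]
    · exact Integrable.of_bound (hφs.comp hm).aestronglyMeasurable 1
        (ae_of_all _ fun _ => hb _)
  have hfg : ∀ x, |f x * g x| ≤ 1 := fun x => by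
    rw [abs_mul]; exact mul_le_one₀ (hf.abs_le_one x) (abs_nonneg _) (hg.abs_le_one x)
  set h := s * c
  have hF := hf.average μ h
  have hG := hg.average μ h
  set F := fun x => ∫ y, f (x + h • y) ∂μ
  set G := fun x => ∫ y, g (x + h • y) ∂μ
  have h1 := hB _ _ _ _ hF hG
  have h2 : ∫ x, (∫ y, f (h • x + h • y) * g (h • x + h • y) ∂μ) ∂μ
      - ∫ x, F (h • x) * G (h • x) ∂μ ≤ B := by
    have hm : Measurable (Function.uncurry fun x y : Fin n → ℝ =>
        f (h • x + h • y) * g (h • x + h • y)) :=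
      (hf.measurable.mul hg.measurable).comp
        (by fun_prop : Measurable fun z : (Fin n → ℝ) × (Fin n → ℝ) => h • z.1 + h • z.2)
    have hi1 : Integrable (fun x => ∫ y, f (h • x + h • y) * g (h • x + h • y) ∂μ) μ :=
      Integrable.of_bound hm.stronglyMeasurable.integral_prod_right.aestronglyMeasurable 1
        (ae_of_all _ fun x => by
          simpa using norm_integral_le_of_norm_le_const (μ := μ)
            (f := fun y => f (h • x + h • y) * g (h • x + h • y)) (ae_of_all _ fun y => hfg (h • x + h • y)))
    have hi2 : Integrable (fun x => F (h • x) * G (h • x)) μ :=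
      Integrable.of_bound ((hF.measurable.mul hG.measurable).comp
        (measurable_const_smul h)).aestronglyMeasurable 1
        (ae_of_all _ fun x => by
          rw [Real.norm_eq_abs, abs_mul]
          exact mul_le_one₀ (hF.abs_le_one _) (abs_nonneg _) (hG.abs_le_one _))
    rw [← integral_sub hi1 hi2]
    have := integral_mono (μ := μ) (hi1.sub hi2) (integrable_const B) fun x =>
      hB _ _ _ _ (hf.translate (h • x)) (hg.translate (h • x))
    simpa using this
  unfold scaledCov at h1 ⊢
  rw [key f hf.measurable hf.abs_le_one, key g hg.measurable hg.abs_le_one,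
    key (fun x => f x * g x) (hf.measurable.mul hg.measurable) hfg]
  linarith

lemma HasMonotoneGradient.abs_linear_le {n : ℕ} {I : Finset (Fin n)} {L M : ℝ}
    {f : (Fin n → ℝ) → ℝ} {p : Fin n → (Fin n → ℝ) → ℝ} (hf : HasMonotoneGradient I L M f p)
    (x y : Fin n → ℝ) : |∑ i, p i x * y i| ≤ L * ‖y‖ := by
  calc |∑ i, p i x * y i| ≤ ∑ i, |p i x * y i| := Finset.abs_sum_le_sum_abs _ _
    _ ≤ ∑ i, p i x * ‖y‖ := Finset.sum_le_sum fun i _ => by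
        rw [abs_mul, abs_of_nonneg (hf.grad_nonneg i x)]
        exact mul_le_mul_of_nonneg_left (norm_le_pi_norm y i) (hf.grad_nonneg i x)
    _ = (∑ i, p i x) * ‖y‖ := by rw [Finset.sum_mul]
    _ ≤ L * ‖y‖ := by gcongr; exact hf.sum_grad_le x

lemma scaledCov_le_of_le_one {n : ℕ} {I J : Finset (Fin n)} {L M κ : ℝ} (hM : 0 ≤ M)
    {μ : Measure (Fin n → ℝ)}
    [IsProbabilityMeasure μ] (hμ : MemLp id 4 μ) (hμ0 : ∀ i, ∫ x, x i ∂μ = 0)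
    (hκ : ∀ i ∈ I, ∀ j ∈ J, ∫ x, x i * x j ∂μ ≤ κ) (hκ0 : 0 ≤ κ) :
    ∃ C, ∀ s, 0 ≤ s → s ≤ 1 → ∀ f g p q, HasMonotoneGradient I L M f p →
      HasMonotoneGradient J L M g q → scaledCov μ s f g ≤ s ^ 2 * (κ * L ^ 2) + C * s ^ 3 := by
  have hnorm (k : ℕ) (hk : k ≤ 4) : Integrable (fun x => ‖x‖ ^ k) μ := by
    have : MemLp id (k : ℕ) μ := hμ.mono_exponent (by exact_mod_cast hk)
    simpa using this.integrable_norm_pow'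
  have hcoord (i : Fin n) : Integrable (fun x : Fin n → ℝ => x i) μ :=
    (hnorm 1 (by norm_num)).mono' (measurable_pi_apply i).aestronglyMeasurable
      (ae_of_all _ fun x => by simpa using norm_le_pi_norm x i)
  have hcoord2 (i j : Fin n) : Integrable (fun x : Fin n → ℝ => x i * x j) μ :=
    (hnorm 2 (by norm_num)).mono' (by fun_prop) (ae_of_all _ fun x => by
      rw [norm_mul, sq]
      exact mul_le_mul (norm_le_pi_norm x i) (norm_le_pi_norm x j) (norm_nonneg _)
        (norm_nonneg _))
  set m2 := ∫ x, ‖x‖ ^ 2 ∂μ with hm2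
  set m3 := ∫ x, ‖x‖ ^ 3 ∂μ with hm3
  set m4 := ∫ x, ‖x‖ ^ 4 ∂μ with hm4
  have hm4' : 0 ≤ m4 := integral_nonneg fun x => by positivity
  refine ⟨2 * L * M * m3 + M ^ 2 * m4 + M ^ 2 * m2 ^ 2, fun s hs0 hs1 f g p q hf hg => ?_⟩
  have hL := hf.nonneg
  -- the mean of an increment is bounded by the mean of the Taylor remainder
  have hmean {I' : Finset (Fin n)} {φ : (Fin n → ℝ) → ℝ} {r : Fin n → (Fin n → ℝ) → ℝ}
      (hφ : HasMonotoneGradient I' L M φ r) :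
      |∫ x, (φ (s • x) - φ 0) ∂μ| ≤ M * s ^ 2 * m2 := by
    have hlin : ∫ x, ∑ i, r i 0 * (s * x i) ∂μ = 0 := by
      rw [integral_finsetSum _ fun i _ => ((hcoord i).const_mul _).const_mul _]
      simp [integral_const_mul, hμ0]
    have hint : Integrable (fun x => ∑ i, r i 0 * (s * x i)) μ :=
      integrable_finsetSum _ fun i _ => ((hcoord i).const_mul _).const_mul _
    have hφi : Integrable (fun x => φ (s • x) - φ 0) μ :=
      (hφ.integrable_comp (measurable_const_smul s)).sub (integrable_const _)
    have : ∫ x, (φ (s • x) - φ 0) ∂μ = ∫ x, (φ (s • x) - φ 0 - ∑ i, r i 0 * (s * x i)) ∂μ := by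
      rw [integral_sub hφi hint, hlin, sub_zero]
    rw [this, hm2, ← integral_const_mul]
    rw [← Real.norm_eq_abs]
    refine norm_integral_le_of_norm_le ((hnorm 2 (by norm_num)).const_mul _)
      (ae_of_all _ fun x => ?_)
    have := hφ.taylor 0 (s • x)
    simp only [Pi.smul_apply, smul_eq_mul, Pi.zero_apply, sub_zero, norm_smul,
      Real.norm_eq_abs, abs_of_nonneg hs0, mul_pow] at this ⊢
    linarith
  have hFi := hf.integrable_comp (μ := μ) (measurable_const_smul s)
  have hGi := hg.integrable_comp (μ := μ) (measurable_const_smul s)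
  have hFG : Integrable (fun x => f (s • x) * g (s • x)) μ :=
    hGi.bdd_mul hFi.aestronglyMeasurable (ae_of_all _ fun x => hf.abs_le_one _)
  have hcov : scaledCov μ s f g = ∫ x, (f (s • x) - f 0) * (g (s • x) - g 0) ∂μ
      - (∫ x, (f (s • x) - f 0) ∂μ) * ∫ x, (g (s • x) - g 0) ∂μ := by
    have e : ∀ x, (f (s • x) - f 0) * (g (s • x) - g 0)
        = f (s • x) * g (s • x) - (f (s • x) * g 0 + f 0 * g (s • x) - f 0 * g 0) :=
      fun x => by ring
    simp_rw [e]
    have e1 : Integrable (fun x => f (s • x) * g 0 + f 0 * g (s • x)) μ :=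
      (hFi.mul_const _).add (hGi.const_mul _)
    have e2 : Integrable (fun x => f (s • x) * g 0 + f 0 * g (s • x) - f 0 * g 0) μ :=
      e1.sub (integrable_const _)
    rw [integral_sub hFG e2, integral_sub e1 (integrable_const _),
      integral_add (hFi.mul_const _) (hGi.const_mul _), integral_sub hFi (integrable_const _),
      integral_sub hGi (integrable_const _), integral_mul_const, integral_const_mul]
    simp only [integral_const, probReal_univ, smul_eq_mul, one_mul]
    unfold scaledCov
    ring
  have hbil : ∫ x, (∑ i, p i 0 * x i) * (∑ j, q j 0 * x j) ∂μ ≤ κ * L ^ 2 := by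
    have e : ∀ x : Fin n → ℝ, (∑ i, p i 0 * x i) * (∑ j, q j 0 * x j)
        = ∑ i, ∑ j, p i 0 * q j 0 * (x i * x j) := fun x => by
      rw [Finset.sum_mul_sum]
      exact Finset.sum_congr rfl fun i _ => Finset.sum_congr rfl fun j _ => by ring
    simp_rw [e]
    rw [integral_finsetSum _ fun i _ => integrable_finsetSum _ fun j _ =>
      (hcoord2 i j).const_mul _]
    calc ∑ i, ∫ x, ∑ j, p i 0 * q j 0 * (x i * x j) ∂μ
        = ∑ i, ∑ j, p i 0 * q j 0 * ∫ x, x i * x j ∂μ :=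
          Finset.sum_congr rfl fun i _ => by
            rw [integral_finsetSum _ fun j _ => (hcoord2 i j).const_mul _]
            simp_rw [integral_const_mul]
      _ ≤ ∑ i, ∑ j, p i 0 * q j 0 * κ :=
          Finset.sum_le_sum fun i _ => Finset.sum_le_sum fun j _ => by
            by_cases hi : i ∈ I
            · by_cases hj : j ∈ J
              · exact mul_le_mul_of_nonneg_left (hκ i hi j hj)
                  (mul_nonneg (hf.grad_nonneg i 0) (hg.grad_nonneg j 0))
              · simp [hg.grad_eq_zero j hj]
            · simp [hf.grad_eq_zero i hi]
      _ = κ * ((∑ i, p i 0) * ∑ j, q j 0) := by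
          rw [Finset.sum_mul_sum, Finset.mul_sum]
          refine Finset.sum_congr rfl fun i _ => ?_
          rw [Finset.mul_sum]
          exact Finset.sum_congr rfl fun j _ => by ring
      _ ≤ κ * L ^ 2 := by
          rw [sq]
          refine mul_le_mul_of_nonneg_left ?_ hκ0
          exact mul_le_mul (hf.sum_grad_le 0) (hg.sum_grad_le 0)
            (Finset.sum_nonneg fun j _ => hg.grad_nonneg j 0) hL
  have hprod : ∫ x, (f (s • x) - f 0) * (g (s • x) - g 0) ∂μ
      ≤ s ^ 2 * (κ * L ^ 2) + (2 * L * M * s ^ 3 * m3 + M ^ 2 * s ^ 4 * m4) := by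
    have hbi : Integrable (fun x => (∑ i, p i 0 * x i) * (∑ j, q j 0 * x j)) μ := by
      refine ((hnorm 2 (by norm_num)).const_mul (L * L)).mono' (by fun_prop)
        (ae_of_all _ fun x => ?_)
      rw [Real.norm_eq_abs, abs_mul]
      calc _ ≤ (L * ‖x‖) * (L * ‖x‖) := mul_le_mul (hf.abs_linear_le 0 x)
            (hg.abs_linear_le 0 x) (abs_nonneg _) (by positivity)
        _ = _ := by ring
    have hpt : ∀ x, (f (s • x) - f 0) * (g (s • x) - g 0)
        ≤ s ^ 2 * ((∑ i, p i 0 * x i) * (∑ j, q j 0 * x j))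
          + (2 * L * M * s ^ 3 * ‖x‖ ^ 3 + M ^ 2 * s ^ 4 * ‖x‖ ^ 4) := fun x => by
      have t1 := hf.taylor 0 (s • x)
      have t2 := hg.taylor 0 (s • x)
      have l1 := hf.abs_linear_le 0 x
      have l2 := hg.abs_linear_le 0 x
      have e (r : Fin n → (Fin n → ℝ) → ℝ) :
          ∑ i, r i 0 * ((s • x) i - (0 : Fin n → ℝ) i) = s * ∑ i, r i 0 * x i := by
        rw [Finset.mul_sum]
        exact Finset.sum_congr rfl fun i _ => by simp; ring
      rw [e, sub_zero, norm_smul, Real.norm_eq_abs, abs_of_nonneg hs0] at t1 t2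
      set a := ∑ i, p i 0 * x i
      set b := ∑ i, q i 0 * x i
      set N := ‖x‖
      have hN : 0 ≤ N := norm_nonneg _
      obtain ⟨u, hu⟩ : ∃ u, u = f (s • x) - f 0 - s * a := ⟨_, rfl⟩
      obtain ⟨v, hv⟩ : ∃ v, v = g (s • x) - g 0 - s * b := ⟨_, rfl⟩
      rw [← hu] at t1
      rw [← hv] at t2
      have hu' : f (s • x) - f 0 = s * a + u := by linarith
      have hv' : g (s • x) - g 0 = s * b + v := by linarith
      rw [hu', hv']
      have b1 : a * v ≤ (L * N) * (M * (s * N) ^ 2) := (le_abs_self _).trans <| by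
        rw [abs_mul]; exact mul_le_mul l1 t2 (abs_nonneg _) (by positivity)
      have b2 : u * b ≤ (M * (s * N) ^ 2) * (L * N) := (le_abs_self _).trans <| by
        rw [abs_mul]; exact mul_le_mul t1 l2 (abs_nonneg _) (by positivity)
      have b3 : u * v ≤ (M * (s * N) ^ 2) * (M * (s * N) ^ 2) := (le_abs_self _).trans <| by
        rw [abs_mul]; exact mul_le_mul t1 t2 (abs_nonneg _) (by positivity)
      have b1' := mul_le_mul_of_nonneg_left b1 hs0
      have b2' := mul_le_mul_of_nonneg_left b2 hs0
      linarith
    have hrem : Integrable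
        (fun x => 2 * L * M * s ^ 3 * ‖x‖ ^ 3 + M ^ 2 * s ^ 4 * ‖x‖ ^ 4) μ :=
      ((hnorm 3 (by norm_num)).const_mul _).add ((hnorm 4 le_rfl).const_mul _)
    have hint : Integrable (fun x => (f (s • x) - f 0) * (g (s • x) - g 0)) μ := by
      refine (hGi.sub (integrable_const (g 0))).bdd_mul (c := 2)
        (hFi.sub (integrable_const (f 0))).aestronglyMeasurable (ae_of_all _ fun x => ?_)
      have := (abs_sub (f (s • x)) (f 0)).trans
        (add_le_add (hf.abs_le_one (s • x)) (hf.abs_le_one 0))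
      norm_num at this ⊢
      exact this
    have := integral_mono hint ((hbi.const_mul (s ^ 2)).add hrem) hpt
    refine this.trans ?_
    simp only [Pi.add_apply]
    rw [integral_add (hbi.const_mul (s ^ 2)) hrem, integral_const_mul,
      integral_add ((hnorm 3 (by norm_num)).const_mul _) ((hnorm 4 le_rfl).const_mul _),
      integral_const_mul, integral_const_mul]
    gcongr
  have hm : -((∫ x, (f (s • x) - f 0) ∂μ) * ∫ x, (g (s • x) - g 0) ∂μ)
      ≤ (M * s ^ 2 * m2) * (M * s ^ 2 * m2) := (neg_le_abs _).trans <| by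
    rw [abs_mul]
    exact mul_le_mul (hmean hf) (hmean hg) (abs_nonneg _) ((abs_nonneg _).trans (hmean hf))
  have hs4 : s ^ 4 ≤ s ^ 3 := pow_le_pow_of_le_one hs0 hs1 (by norm_num)
  have h1 : s ^ 4 * (M ^ 2 * m4) ≤ s ^ 3 * (M ^ 2 * m4) := by gcongr
  have h2 : s ^ 4 * (M ^ 2 * m2 ^ 2) ≤ s ^ 3 * (M ^ 2 * m2 ^ 2) := by gcongr
  rw [hcov]
  linarith

lemma scaledCov_one_le {n : ℕ} {I J : Finset (Fin n)} {L M κ : ℝ} (hM : 0 ≤ M)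
    {μ : Measure (Fin n → ℝ)} [IsGaussian μ] (hμ0 : ∫ x, x ∂μ = 0)
    (hκ : ∀ i ∈ I, ∀ j ∈ J, ∫ x, x i * x j ∂μ ≤ κ) (hκ0 : 0 ≤ κ)
    {f g : (Fin n → ℝ) → ℝ} {p q : Fin n → (Fin n → ℝ) → ℝ}
    (hf : HasMonotoneGradient I L M f p) (hg : HasMonotoneGradient J L M g q) :
    scaledCov μ 1 f g ≤ κ * L ^ 2 := by
  obtain ⟨c, hc⟩ : ∃ c : ℝ, c = √2 / 2 := ⟨_, rfl⟩
  have hc0 : 0 ≤ c := by rw [hc]; positivity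
  have hc2 : c ^ 2 = 1 / 2 := by rw [hc, div_pow, Real.sq_sqrt (by norm_num)]; norm_num
  have hc1 : c < 1 := by nlinarith
  have hstable : (μ.prod μ).map (fun z => c • (z.1 + z.2)) = μ := by
    have h := IsGaussian.map_rotation_eq_self (μ := μ) hμ0 (Real.pi / 4)
    have h' := congrArg (fun ν => ν.map Prod.fst) h
    rw [Measure.map_map measurable_fst (by fun_prop)] at h'
    simp only [Measure.map_fst_prod, measure_univ, one_smul] at h'
    convert h' using 2
    ext z : 1
    simp [ContinuousLinearMap.rotation_apply, hc]
  have hmem : MemLp id 4 μ := IsGaussian.memLp_id μ 4 (by norm_num)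
  have hcoord (i : Fin n) : ∫ x, x i ∂μ = 0 := by
    have := IsGaussian.integral_dual (μ := μ)
      (ContinuousLinearMap.proj (R := ℝ) (φ := fun _ : Fin n => ℝ) i)
    simpa [hμ0] using this
  obtain ⟨C, hC⟩ := scaledCov_le_of_le_one (L := L) hM hmem hcoord hκ hκ0
  have hiter (m : ℕ) : ∀ B j, (∀ f g p q, HasMonotoneGradient I L M f p →
      HasMonotoneGradient J L M g q → scaledCov μ (c ^ (j + m)) f g ≤ B) →
      ∀ f g p q, HasMonotoneGradient I L M f p →
      HasMonotoneGradient J L M g q → scaledCov μ (c ^ j) f g ≤ 2 ^ m * B := by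
    induction m with
    | zero => intro B j h; simpa using h
    | succ m ih =>
      intro B j h f g p q hf hg
      have h1 := ih B (j + 1) (by simpa only [add_assoc, add_comm 1 m] using h)
      rw [pow_succ', mul_assoc]
      exact scaledCov_mul_le hstable (by rwa [← pow_succ]) hf hg
  have hbound (m : ℕ) : scaledCov μ 1 f g ≤ κ * L ^ 2 + C * c ^ m := by
    have h := hiter m _ 0 (fun f g p q hf hg => hC (c ^ (0 + m)) (by positivity)
      (pow_le_one₀ hc0 hc1.le) f g p q hf hg) f g p q hf hg
    rw [pow_zero, zero_add] at h
    refine h.trans (le_of_eq ?_)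
    have e : (c ^ m) ^ 2 = (1 / 2) ^ m := by rw [← pow_mul, mul_comm, pow_mul, hc2]
    have e2 : (2 : ℝ) ^ m * (1 / 2) ^ m = 1 := by rw [← mul_pow]; norm_num
    have e3 : (c ^ m) ^ 3 = (1 / 2) ^ m * c ^ m := by rw [← e]; ring
    rw [e, e3]
    linear_combination (κ * L ^ 2 + C * c ^ m) * e2
  have hlim : Filter.Tendsto (fun m : ℕ => κ * L ^ 2 + C * c ^ m) Filter.atTop
      (nhds (κ * L ^ 2)) := by
    simpa using ((tendsto_pow_atTop_nhds_zero_of_lt_one hc0 hc1).const_mul C).const_add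
      (κ * L ^ 2)
  exact ge_of_tendsto' hlim hbound

lemma Monotone.lipschitzWith_of_add_const_le {n : ℕ} {L : ℝ} (hL : 0 ≤ L)
    {f : (Fin n → ℝ) → ℝ} (hmono : Monotone f)
    (hshift : ∀ x u, 0 ≤ u → f (fun i => x i + u) ≤ f x + L * u) :
    LipschitzWith L.toNNReal f := by
  refine LipschitzWith.of_le_add_mul _ fun x y => ?_
  rw [Real.coe_toNNReal _ hL]
  refine (hmono fun i => ?_).trans (hshift y (dist x y) dist_nonneg)
  have := (le_abs_self _).trans ((Real.dist_eq (x i) (y i)).symm.le.trans (dist_le_pi_dist x y i))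
  linarith

open scoped Convolution in
lemma exists_hasMonotoneGradient_approx {n : ℕ} {I : Finset (Fin n)} {L : ℝ} (hL : 0 ≤ L)
    {f : (Fin n → ℝ) → ℝ} (h0 : ∀ x, 0 ≤ f x) (h1 : ∀ x, f x ≤ 1) (hmono : Monotone f)
    (hshift : ∀ x u, 0 ≤ u → f (fun i => x i + u) ≤ f x + L * u)
    (hsupp : ∀ x y : Fin n → ℝ, (∀ i ∈ I, x i = y i) → f x = f y) {δ : ℝ} (hδ : 0 < δ) :
    ∃ M F p, 0 ≤ M ∧ HasMonotoneGradient I L M F p ∧ ∀ x, |F x - f x| ≤ L * δ := by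
  have hlip := hmono.lipschitzWith_of_add_const_le hL hshift
  have hlip' : ∀ x y, |f x - f y| ≤ L * ‖x - y‖ := fun x y => by
    simpa [Real.dist_eq, dist_eq_norm, Real.coe_toNNReal _ hL] using hlip.dist_le_mul x y
  have hcont := hlip.continuous
  let ψ : ContDiffBump (0 : Fin n → ℝ) := ⟨δ / 2, δ, by linarith, by linarith⟩
  set w := ψ.normed volume with hw
  have hwc : HasCompactSupport w := ψ.hasCompactSupport_normed
  have hwd : ContDiff ℝ 1 w := ψ.contDiff_normed
  have hw0 : ∀ t, 0 ≤ w t := ψ.nonneg_normed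
  have hw1 : ∫ t, w t = 1 := ψ.integral_normed
  have hwi : Integrable w := ψ.integrable_normed
  set F : (Fin n → ℝ) → ℝ := w ⋆[ContinuousLinearMap.lsmul ℝ ℝ, volume] f with hF
  have hFx (x) : F x = ∫ t, w t * f (x - t) := rfl
  have hint (x) : Integrable fun t => w t * f (x - t) :=
    hwi.mul_bdd (c := 1) (hcont.comp (by fun_prop)).aestronglyMeasurable
      (ae_of_all _ fun t => by
        rw [Real.norm_eq_abs, abs_of_nonneg (h0 _)]; exact h1 _)
  have hle (v : Fin n → ℝ) (K : ℝ) (h : ∀ z, f (z + v) ≤ f z + K) (x) : F (x + v) ≤ F x + K := by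
    have e : F x + K = ∫ t, (w t * f (x - t) + w t * K) := by
      rw [integral_add (hint x) (hwi.mul_const K), integral_mul_const, hw1, one_mul, hFx]
    rw [e, hFx]
    refine integral_mono (hint _) ((hint x).add (hwi.mul_const K)) fun t => ?_
    have := mul_le_mul_of_nonneg_left (h (x - t)) (hw0 t)
    rw [sub_add_eq_add_sub, mul_add] at this
    exact this
  set T := (ContinuousLinearMap.lsmul ℝ ℝ : ℝ →L[ℝ] ℝ →L[ℝ] ℝ).precompL (Fin n → ℝ) with hT
  set D : (Fin n → ℝ) → ((Fin n → ℝ) →L[ℝ] ℝ) := fderiv ℝ w ⋆[T, volume] f with hD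
  have hder (x) : HasFDerivAt F (D x) x :=
    hwc.hasFDerivAt_convolution_left _ hwd hcont.locallyIntegrable x
  have hDx (x) : D x = ∫ t, f (x - t) • fderiv ℝ w t := by
    refine integral_congr_ae (ae_of_all _ fun t => ?_)
    ext v
    simp [hT, mul_comm]
  have hw'c : Continuous (fderiv ℝ w) := hwd.continuous_fderiv (by norm_num)
  have hw'i : Integrable (fderiv ℝ w) :=
    hw'c.integrable_of_hasCompactSupport (hwc.fderiv (𝕜 := ℝ))
  have hDint (x) : Integrable fun t => f (x - t) • fderiv ℝ w t := by
    refine hw'i.norm.mono' (Continuous.aestronglyMeasurable (by fun_prop))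
      (ae_of_all _ fun t => ?_)
    rw [norm_smul, Real.norm_eq_abs, abs_of_nonneg (h0 _)]
    exact mul_le_of_le_one_left (norm_nonneg _) (h1 _)
  obtain ⟨M, hM⟩ : ∃ M, M = L * ∫ t, ‖fderiv ℝ w t‖ := ⟨_, rfl⟩
  have hM0 : 0 ≤ M := by
    rw [hM]
    have : 0 ≤ ∫ t, ‖fderiv ℝ w t‖ := integral_nonneg fun t => norm_nonneg _
    positivity
  have hDlip (x y) : ‖D y - D x‖ ≤ M * ‖y - x‖ := by
    rw [hDx, hDx, ← integral_sub (hDint y) (hDint x)]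
    calc _ ≤ ∫ t, L * ‖y - x‖ * ‖fderiv ℝ w t‖ := by
          refine norm_integral_le_of_norm_le (hw'i.norm.const_mul _) (ae_of_all _ fun t => ?_)
          have e : f (y - t) • fderiv ℝ w t - f (x - t) • fderiv ℝ w t
              = (f (y - t) - f (x - t)) • fderiv ℝ w t := by ext v; simp [sub_mul]
          rw [e, norm_smul]
          refine mul_le_mul_of_nonneg_right ?_ (norm_nonneg _)
          simpa using hlip' (y - t) (x - t)
      _ = _ := by rw [integral_const_mul, hM]; ring
  have htaylor (x y) : |F y - F x - D x (y - x)| ≤ M * ‖y - x‖ ^ 2 := by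
    have := (convex_closedBall x ‖y - x‖).norm_image_sub_le_of_norm_hasFDerivWithin_le'
      (f := F) (f' := D) (φ := D x) (C := M * ‖y - x‖) (x := x) (y := y)
      (fun z _ => (hder z).hasFDerivWithinAt)
      (fun z hz => (hDlip x z).trans (mul_le_mul_of_nonneg_left
        (by simpa [dist_eq_norm] using hz) hM0)) (by simp) (by simp [dist_eq_norm])
    rw [Real.norm_eq_abs] at this
    linarith
  have hdir (x v : Fin n → ℝ) (K : ℝ) (h : ∀ t > 0, ∀ z, f (z + t • v) ≤ f z + t * K) :
      D x v ≤ K := by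
    have hb : ∀ t : ℝ, 0 < t → D x v ≤ K + t * (M * ‖v‖ ^ 2) := fun t ht => by
      have a1 := hle _ _ (h t ht) x
      have a2 := (abs_le.1 (htaylor x (x + t • v))).1
      rw [add_sub_cancel_left, map_smul, smul_eq_mul, norm_smul, Real.norm_eq_abs,
        abs_of_pos ht] at a2
      have : t * D x v ≤ t * (K + t * (M * ‖v‖ ^ 2)) := by linarith
      exact le_of_mul_le_mul_left this ht
    have hlim : Filter.Tendsto (fun t : ℝ => K + t * (M * ‖v‖ ^ 2)) (nhdsWithin 0 (Set.Ioi 0))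
        (nhds K) := by
      have : Continuous fun t : ℝ => K + t * (M * ‖v‖ ^ 2) := by fun_prop
      simpa using (this.tendsto 0).mono_left nhdsWithin_le_nhds
    exact ge_of_tendsto hlim (by filter_upwards [self_mem_nhdsWithin] with t ht using hb t ht)
  have hDsum (x v : Fin n → ℝ) : ∑ i, D x (Pi.single i 1) * v i = D x v := by
    conv_rhs => rw [pi_eq_sum_univ' v, map_sum]
    refine Finset.sum_congr rfl fun i _ => ?_
    rw [map_smul, smul_eq_mul, mul_comm]
  have hDcont : Continuous D :=
    (LipschitzWith.of_dist_le_mul (K := M.toNNReal) fun y x => by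
      rw [Real.coe_toNNReal _ hM0, dist_eq_norm, dist_eq_norm]; exact hDlip x y).continuous
  refine ⟨M, F, fun i x => D x (Pi.single i 1), hM0, ?_, fun x => ?_⟩
  · refine ⟨?_, fun x => ?_, fun i => ?_, fun i x => ?_, fun x => ?_, fun i hi x => ?_,
      fun x y => ?_⟩
    · exact (continuous_iff_continuousAt.2 fun x => (hder x).continuousAt).measurable
    · have hFpos : 0 ≤ F x := integral_nonneg fun t => mul_nonneg (hw0 t) (h0 (x - t))
      rw [abs_of_nonneg hFpos, hFx, ← hw1]
      exact integral_mono (hint x) hwi fun t => mul_le_of_le_one_right (hw0 t) (h1 _)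
    · exact Continuous.measurable (by fun_prop)
    · have := hdir x (-Pi.single i 1) 0 fun t ht z => by
        rw [mul_zero, add_zero]
        refine hmono ?_
        have : (0 : Fin n → ℝ) ≤ t • Pi.single i 1 :=
          smul_nonneg ht.le (Pi.single_nonneg.2 zero_le_one)
        simpa using this
      rw [map_neg] at this
      linarith
    · have := hdir x 1 L fun t ht z => by
        have := hshift z t ht.le
        rw [mul_comm]
        convert this using 2
        ext i
        simp
      simpa using (hDsum x 1).le.trans this
    · have hz : ∀ a : ℝ, D x (a • Pi.single i 1) ≤ 0 := fun a => hdir x _ 0 fun t ht z => by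
        rw [mul_zero, add_zero]
        refine (hsupp _ _ fun j hj => ?_).le
        have : j ≠ i := fun h => hi (h ▸ hj)
        simp [this]
      have z1 := hz 1
      have z2 := hz (-1)
      rw [map_smul, smul_eq_mul] at z1 z2
      linarith
    · simpa only [← Pi.sub_apply, hDsum x (y - x)] using htaylor x y
  · have := ψ.dist_normed_convolution_le (μ := volume) (g := f) (x₀ := x) (ε := L * δ)
      hcont.aestronglyMeasurable fun y hy => by
        rw [Real.dist_eq]
        refine (hlip' y x).trans (mul_le_mul_of_nonneg_left ?_ hL)
        rw [← dist_eq_norm]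
        exact (Metric.mem_ball.1 hy).le
    exact this

/-- A Gaussian covariance bound for monotone Lipschitz functions. -/
lemma scaledCov_one_le_of_monotone {n : ℕ} {I J : Finset (Fin n)} {L κ : ℝ} (hL : 0 ≤ L)
    {μ : Measure (Fin n → ℝ)} [IsGaussian μ] (hμ0 : ∫ x, x ∂μ = 0)
    (hκ : ∀ i ∈ I, ∀ j ∈ J, ∫ x, x i * x j ∂μ ≤ κ) (hκ0 : 0 ≤ κ)
    {f g : (Fin n → ℝ) → ℝ}
    (hf0 : ∀ x, 0 ≤ f x) (hf1 : ∀ x, f x ≤ 1) (hf : Monotone f)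
    (hfL : ∀ x u, 0 ≤ u → f (fun i => x i + u) ≤ f x + L * u)
    (hfI : ∀ x y : Fin n → ℝ, (∀ i ∈ I, x i = y i) → f x = f y)
    (hg0 : ∀ x, 0 ≤ g x) (hg1 : ∀ x, g x ≤ 1) (hg : Monotone g)
    (hgL : ∀ x u, 0 ≤ u → g (fun i => x i + u) ≤ g x + L * u)
    (hgJ : ∀ x y : Fin n → ℝ, (∀ i ∈ J, x i = y i) → g x = g y) :
    ∫ x, f x * g x ∂μ - (∫ x, f x ∂μ) * ∫ x, g x ∂μ ≤ κ * L ^ 2 := by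
  have hfi : Integrable f μ := Integrable.of_bound
    (hf.lipschitzWith_of_add_const_le hL hfL).continuous.aestronglyMeasurable 1
    (ae_of_all _ fun x => by rw [Real.norm_eq_abs, abs_of_nonneg (hf0 x)]; exact hf1 x)
  have hgi : Integrable g μ := Integrable.of_bound
    (hg.lipschitzWith_of_add_const_le hL hgL).continuous.aestronglyMeasurable 1
    (ae_of_all _ fun x => by rw [Real.norm_eq_abs, abs_of_nonneg (hg0 x)]; exact hg1 x)
  have hfg : Integrable (fun x => f x * g x) μ :=
    hgi.bdd_mul hfi.aestronglyMeasurable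
      (ae_of_all _ fun x => by rw [Real.norm_eq_abs, abs_of_nonneg (hf0 x)]; exact hf1 x)
  have hbound : ∀ δ : ℝ, 0 < δ →
      ∫ x, f x * g x ∂μ - (∫ x, f x ∂μ) * ∫ x, g x ∂μ ≤ κ * L ^ 2 + 4 * L * δ := fun δ hδ => by
    obtain ⟨M, F, p, hM, hF, hFf⟩ := exists_hasMonotoneGradient_approx hL hf0 hf1 hf hfL hfI hδ
    obtain ⟨M', G, q, hM', hG, hGg⟩ := exists_hasMonotoneGradient_approx hL hg0 hg1 hg hgL hgJ hδ
    have hc := scaledCov_one_le (hM.trans (le_max_left M M')) hμ0 hκ hκ0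
      (hF.mono (le_max_left M M')) (hG.mono (le_max_right M M'))
    simp only [scaledCov, one_smul] at hc
    have hFi : Integrable F μ := hF.integrable_comp measurable_id
    have hGi : Integrable G μ := hG.integrable_comp measurable_id
    have hFG : Integrable (fun x => F x * G x) μ :=
      hGi.bdd_mul hFi.aestronglyMeasurable (ae_of_all _ fun x => hF.abs_le_one x)
    have close {φ φ' : (Fin n → ℝ) → ℝ} {C : ℝ} (h : Integrable φ μ) (h' : Integrable φ' μ)
        (hb : ∀ x, |φ x - φ' x| ≤ C) : |∫ x, φ x ∂μ - ∫ x, φ' x ∂μ| ≤ C := by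
      rw [← integral_sub h h']
      simpa using norm_integral_le_of_norm_le_const (μ := μ) (f := fun x => φ x - φ' x)
        (ae_of_all _ hb)
    have bound {φ : (Fin n → ℝ) → ℝ} (hb : ∀ x, |φ x| ≤ 1) : |∫ x, φ x ∂μ| ≤ 1 := by
      simpa using norm_integral_le_of_norm_le_const (μ := μ) (f := φ) (ae_of_all _ hb)
    have hLδ : 0 ≤ L * δ := by positivity
    have mulclose {a b a' b' : ℝ} (h : |a' - a| ≤ L * δ) (h' : |b' - b| ≤ L * δ)
        (hb : |b'| ≤ 1) (ha : |a| ≤ 1) : |a' * b' - a * b| ≤ 2 * (L * δ) := by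
      have e : a' * b' - a * b = (a' - a) * b' + a * (b' - b) := by ring
      rw [e]
      refine (abs_add_le _ _).trans ?_
      rw [abs_mul, abs_mul]
      have := mul_le_of_le_one_right (abs_nonneg (a' - a)) hb
      have := mul_le_of_le_one_left (abs_nonneg (b' - b)) ha
      linarith
    have hfa : ∀ x, |f x| ≤ 1 := fun x => by rw [abs_of_nonneg (hf0 x)]; exact hf1 x
    have c1 := close hFG hfg fun x => mulclose (hFf x) (hGg x) (hG.abs_le_one x) (hfa x)
    have c2 := mulclose (close hFi hfi hFf) (close hGi hgi hGg) (bound hG.abs_le_one)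
      (bound hfa)
    have := abs_le.1 c1
    have := abs_le.1 c2
    linarith
  have hlim : Filter.Tendsto (fun t : ℝ => κ * L ^ 2 + 4 * L * t) (nhdsWithin 0 (Set.Ioi 0))
      (nhds (κ * L ^ 2)) := by
    have : Continuous fun t : ℝ => κ * L ^ 2 + 4 * L * t := by fun_prop
    simpa using (this.tendsto 0).mono_left nhdsWithin_le_nhds
  exact ge_of_tendsto hlim (by filter_upwards [self_mem_nhdsWithin] with t ht using hbound t ht)

/-- A function into `[0, 1]` that equals `1` on `A` and, for increasing `A`, vanishes at `x`
unless `x + ε𝟙 ∈ A`. -/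
noncomputable def softIndicator {n : ℕ} (A : Set (Fin n → ℝ)) (ε : ℝ) (x : Fin n → ℝ) : ℝ :=
  sSup {u : ℝ | 0 ≤ u ∧ u ≤ 1 ∧ (u = 0 ∨ (fun i => x i + ε * (1 - u)) ∈ A)}

section SoftIndicator

variable {n : ℕ} {A : Set (Fin n → ℝ)} {ε : ℝ}

lemma IncreasingEvent.mem_of_le (hA : IncreasingEvent A) {x y : Fin n → ℝ} (hx : x ∈ A)
    (h : ∀ i, x i ≤ y i) : y ∈ A := by
  have := hA x hx (y - x) fun i => sub_nonneg.2 (h i)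
  rwa [add_sub_cancel] at this

lemma le_softIndicator {x : Fin n → ℝ} {u : ℝ} (h0 : 0 ≤ u) (h1 : u ≤ 1)
    (h : u = 0 ∨ (fun i => x i + ε * (1 - u)) ∈ A) : u ≤ softIndicator A ε x :=
  le_csSup ⟨1, fun _ hv => hv.2.1⟩ ⟨h0, h1, h⟩

lemma softIndicator_le {x : Fin n → ℝ} {b : ℝ} (hb : 0 ≤ b)
    (h : ∀ u, 0 ≤ u → u ≤ 1 → (fun i => x i + ε * (1 - u)) ∈ A → u ≤ b) :
    softIndicator A ε x ≤ b := by
  refine csSup_le ⟨0, le_rfl, zero_le_one, Or.inl rfl⟩ ?_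
  rintro u ⟨h0, h1, rfl | hu⟩
  · exact hb
  · exact h u h0 h1 hu

lemma softIndicator_nonneg (x : Fin n → ℝ) : 0 ≤ softIndicator A ε x :=
  le_softIndicator le_rfl zero_le_one (Or.inl rfl)

lemma softIndicator_le_one (x : Fin n → ℝ) : softIndicator A ε x ≤ 1 :=
  softIndicator_le zero_le_one fun _ _ h _ => h

lemma softIndicator_eq_one {x : Fin n → ℝ} (hx : x ∈ A) : softIndicator A ε x = 1 :=
  le_antisymm (softIndicator_le_one x)
    (le_softIndicator zero_le_one le_rfl (Or.inr (by simpa using hx)))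

lemma IncreasingEvent.mem_of_softIndicator_pos (hA : IncreasingEvent A) (hε : 0 < ε)
    {x : Fin n → ℝ} (hx : 0 < softIndicator A ε x) : (fun i => x i + ε) ∈ A := by
  by_contra h
  refine hx.not_ge (softIndicator_le le_rfl fun u h0 _ hu => ?_)
  refine absurd (hA.mem_of_le hu fun i => ?_) h
  nlinarith

lemma IncreasingEvent.monotone_softIndicator (hA : IncreasingEvent A) :
    Monotone (softIndicator A ε) := fun x y hxy =>
  softIndicator_le (softIndicator_nonneg y) fun u h0 h1 hu =>
    le_softIndicator h0 h1 (Or.inr (hA.mem_of_le hu fun i => by simpa using hxy i))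

lemma softIndicator_add_le (hε : 0 < ε) (x : Fin n → ℝ) (v : ℝ) (hv : 0 ≤ v) :
    softIndicator A ε (fun i => x i + v) ≤ softIndicator A ε x + ε⁻¹ * v := by
  have hv' : 0 ≤ ε⁻¹ * v := by positivity
  refine softIndicator_le (add_nonneg (softIndicator_nonneg x) hv') fun u h0 h1 hu => ?_
  rcases le_total u (ε⁻¹ * v) with h | h
  · linarith [softIndicator_nonneg (A := A) (ε := ε) x]
  · rw [← sub_le_iff_le_add]
    refine le_softIndicator (sub_nonneg.2 h) (by linarith) (Or.inr ?_)
    convert hu using 2 with i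
    field_simp
    ring

lemma SupportedOn.softIndicator_eq {I : Finset (Fin n)} (hA : SupportedOn A ↑I)
    (x y : Fin n → ℝ) (h : ∀ i ∈ I, x i = y i) : softIndicator A ε x = softIndicator A ε y := by
  unfold softIndicator
  congr 1
  ext u
  have := hA (fun i => x i + ε * (1 - u)) (fun i => y i + ε * (1 - u)) fun i hi => by
    simp [h i hi]
  simp only [Set.mem_ofPred_eq, this]

end SoftIndicator

lemma kNorm_nonneg {n : ℕ} (K : Fin n → Fin n → ℝ) (I1 I2 : Finset (Fin n)) :
    0 ≤ kNorm K I1 I2 :=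
  Real.sSup_nonneg (by rintro _ ⟨i, _, j, _, rfl⟩; exact abs_nonneg _)

lemma le_kNorm {n : ℕ} (K : Fin n → Fin n → ℝ) {I1 I2 : Finset (Fin n)} {i j : Fin n}
    (hi : i ∈ I1) (hj : j ∈ I2) : K i j ≤ kNorm K I1 I2 := by
  refine (le_abs_self _).trans (le_csSup (Set.Finite.bddAbove ?_) ⟨i, hi, j, hj, rfl⟩)
  refine (Set.finite_range fun z : Fin n × Fin n => |K z.1 z.2|).subset ?_
  rintro _ ⟨i, _, j, _, rfl⟩
  exact ⟨(i, j), rfl⟩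

section GaussianVector

variable {n : ℕ} {Ω : Type*} [MeasureSpace Ω] {X : Ω → Fin n → ℝ}

lemma IsGaussianVector.aemeasurable (hX : IsGaussianVector X) : AEMeasurable X ℙ := by
  refine aemeasurable_pi_iff.2 fun i => ?_
  obtain ⟨m, v, h⟩ := hX (Pi.single i 1)
  have : (fun ω => ∑ j, (Pi.single i 1 : Fin n → ℝ) j * X ω j) = fun ω => X ω i := by
    ext ω
    simp [Pi.single_apply]
  rw [this] at h
  refine AEMeasurable.of_map_ne_zero ?_
  rw [h]
  exact IsProbabilityMeasure.ne_zero _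

lemma IsGaussianVector.isGaussian_map (hX : IsGaussianVector X) :
    IsGaussian (Measure.map X ℙ) := by
  refine isGaussian_of_map_eq_gaussianReal fun T => ?_
  obtain ⟨m, v, h⟩ := hX fun i => T (Pi.single i 1)
  refine ⟨m, v, ?_⟩
  rw [← h, AEMeasurable.map_map_of_aemeasurable (by fun_prop) hX.aemeasurable]
  congr 1
  ext ω
  simp only [Function.comp_apply]
  conv_lhs => rw [pi_eq_sum_univ' (X ω), map_sum]
  exact Finset.sum_congr rfl fun i _ => by rw [map_smul, smul_eq_mul, mul_comm]

lemma IsGaussianVector.cov_le [IsProbabilityMeasure (ℙ : Measure Ω)]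
    (hX : IsGaussianVector X) {K : Fin n → Fin n → ℝ}
    (hK : ∀ i j, K i j = ∫ ω, X ω i * X ω j ∂ℙ - (∫ ω, X ω i ∂ℙ) * (∫ ω, X ω j ∂ℙ))
    {I J : Finset (Fin n)} {L : ℝ} (hL : 0 ≤ L) {f g : (Fin n → ℝ) → ℝ}
    (hf0 : ∀ x, 0 ≤ f x) (hf1 : ∀ x, f x ≤ 1) (hf : Monotone f)
    (hfL : ∀ x u, 0 ≤ u → f (fun i => x i + u) ≤ f x + L * u)
    (hfI : ∀ x y : Fin n → ℝ, (∀ i ∈ I, x i = y i) → f x = f y)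
    (hg0 : ∀ x, 0 ≤ g x) (hg1 : ∀ x, g x ≤ 1) (hg : Monotone g)
    (hgL : ∀ x u, 0 ≤ u → g (fun i => x i + u) ≤ g x + L * u)
    (hgJ : ∀ x y : Fin n → ℝ, (∀ i ∈ J, x i = y i) → g x = g y) :
    ∫ ω, f (X ω) * g (X ω) ∂ℙ - (∫ ω, f (X ω) ∂ℙ) * ∫ ω, g (X ω) ∂ℙ
      ≤ kNorm K I J * L ^ 2 := by
  have hXm := hX.aemeasurable
  have := hX.isGaussian_map
  set ν := Measure.map X ℙ with hν
  set m := ∫ x, x ∂ν with hm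
  set μ := ν.map (fun x => x - m) with hμ
  have hsub : Measurable fun x : Fin n → ℝ => x - m := by fun_prop
  have hfc := (hf.lipschitzWith_of_add_const_le hL hfL).continuous
  have hgc := (hg.lipschitzWith_of_add_const_le hL hgL).continuous
  have hid : Integrable (fun x : Fin n → ℝ => x) ν := IsGaussian.integrable_id
  have hcoord (i : Fin n) : MemLp (fun ω => X ω i) 2 ℙ := by
    have h1 : MemLp (fun x : Fin n → ℝ => x i) 2 ν :=
      IsGaussian.memLp_dual ν (ContinuousLinearMap.proj (R := ℝ) (φ := fun _ : Fin n => ℝ) i) 2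
        (by norm_num)
    exact h1.comp_of_map hXm
  have hci (i : Fin n) : Integrable (fun ω => X ω i) ℙ :=
    (hcoord i).integrable (by norm_num)
  have hmi (i : Fin n) : m i = ∫ ω, X ω i ∂ℙ := by
    rw [hm]
    have := IsGaussian.integral_dual (μ := ν)
      (ContinuousLinearMap.proj (R := ℝ) (φ := fun _ : Fin n => ℝ) i)
    simp only [ContinuousLinearMap.proj_apply] at this
    rw [← this, hν, integral_map hXm (measurable_pi_apply i).aestronglyMeasurable]
  have htransfer {φ : (Fin n → ℝ) → ℝ} (hφ : Continuous φ) :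
      ∫ x, φ x ∂μ = ∫ ω, φ (X ω - m) ∂ℙ := by
    rw [hμ, integral_map hsub.aemeasurable hφ.aestronglyMeasurable, hν,
      integral_map hXm (Continuous.aestronglyMeasurable (by fun_prop))]
  have hμ0 : ∫ x, x ∂μ = 0 := by
    rw [hμ, integral_map hsub.aemeasurable (by fun_prop), integral_sub hid (integrable_const _)]
    simp [hm]
  have hcov (i j : Fin n) : ∫ x, x i * x j ∂μ = K i j := by
    rw [htransfer (by fun_prop), hK]
    have e : ∀ ω, (X ω - m) i * (X ω - m) j
        = X ω i * X ω j - (X ω i * m j + m i * X ω j - m i * m j) := fun ω => by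
      simp only [Pi.sub_apply]; ring
    simp_rw [e]
    have h1 : Integrable (fun ω => X ω i * m j + m i * X ω j) ℙ :=
      ((hci i).mul_const _).add ((hci j).const_mul _)
    have h2 : Integrable (fun ω => X ω i * m j + m i * X ω j - m i * m j) ℙ :=
      h1.sub (integrable_const _)
    have h3 : Integrable (fun ω => X ω i * X ω j) ℙ := (hcoord i).integrable_mul (hcoord j)
    rw [integral_sub h3 h2, integral_sub h1 (integrable_const _),
      integral_add ((hci i).mul_const _) ((hci j).const_mul _), integral_mul_const,
      integral_const_mul]
    simp only [integral_const, probReal_univ, smul_eq_mul, one_mul, ← hmi]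
    ring
  have key := scaledCov_one_le_of_monotone (μ := μ) (I := I) (J := J) (κ := kNorm K I J)
    (f := fun x => f (x + m)) (g := fun x => g (x + m)) hL hμ0
    (fun i hi j hj => (hcov i j).le.trans (le_kNorm K hi hj)) (kNorm_nonneg K I J)
    (fun x => hf0 _) (fun x => hf1 _) (fun x y h => hf (by gcongr))
    (fun x u hu => by
      refine le_of_eq_of_le (congrArg f ?_) (hfL (x + m) u hu)
      ext i; simp; ring)
    (fun x y h => hfI _ _ fun i hi => by simp [h i hi])
    (fun x => hg0 _) (fun x => hg1 _) (fun x y h => hg (by gcongr))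
    (fun x u hu => by
      refine le_of_eq_of_le (congrArg g ?_) (hgL (x + m) u hu)
      ext i; simp; ring)
    (fun x y h => hgJ _ _ fun i hi => by simp [h i hi])
  rw [htransfer (by fun_prop), htransfer (by fun_prop), htransfer (by fun_prop)] at key
  simpa using key

end GaussianVector

/-- `toReal` form of Markov's inequality at level one, for arbitrary sets. -/
lemma toReal_measure_le_integral_of_one_le {Ω : Type*} [MeasurableSpace Ω] {μ : Measure Ω}
    [IsFiniteMeasure μ] {φ : Ω → ℝ} (hφ : Integrable φ μ) (h0 : ∀ ω, 0 ≤ φ ω) {S : Set Ω}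
    (hS : ∀ ω ∈ S, 1 ≤ φ ω) : (μ S).toReal ≤ ∫ ω, φ ω ∂μ := by
  have h := mul_meas_ge_le_integral_of_nonneg (ae_of_all _ h0) hφ 1
  rw [one_mul] at h
  exact (ENNReal.toReal_mono (measure_ne_top _ _) (measure_mono hS)).trans h

lemma integral_le_toReal_measure_of_pos {Ω : Type*} [MeasurableSpace Ω] {μ : Measure Ω}
    [IsFiniteMeasure μ] {φ : Ω → ℝ} (h1 : ∀ ω, φ ω ≤ 1) {S : Set Ω}
    (hS : ∀ ω, 0 < φ ω → ω ∈ S) : ∫ ω, φ ω ∂μ ≤ (μ S).toReal := by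
  by_cases hφ : Integrable φ μ
  · have hm := measurableSet_toMeasurable μ S
    have hi : Integrable ((toMeasurable μ S).indicator fun _ => (1 : ℝ)) μ :=
      (integrable_const _).indicator hm
    have := integral_mono hφ hi fun ω => by
      by_cases h : ω ∈ toMeasurable μ S
      · simpa [h] using h1 ω
      · simpa [h] using fun h' : 0 < φ ω => h (subset_toMeasurable μ S (hS ω h'))
    rw [integral_indicator_const _ hm, smul_eq_mul, mul_one, measureReal_def,
      measure_toMeasurable] at this
    exact this
  · rw [integral_undef hφ]
    exact ENNReal.toReal_nonneg

theorem stmt4 {n : ℕ} {Ω : Type*} [MeasureSpace Ω]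
    [IsProbabilityMeasure (ℙ : Measure Ω)]
    (X : Ω → Fin n → ℝ) (hX : IsGaussianVector X)
    (K : Fin n → Fin n → ℝ)
    (hK : ∀ i j, K i j = ∫ ω, X ω i * X ω j ∂ℙ -
      (∫ ω, X ω i ∂ℙ) * (∫ ω, X ω j ∂ℙ))
    (I1 I2 : Finset (Fin n))
    (hpos : ∀ i ∈ I1, ∀ j ∈ I2, 0 ≤ K i j)
    (A1 A2 : Set (Fin n → ℝ))
    (hInc1 : IncreasingEvent A1) (hInc2 : IncreasingEvent A2)
    (hSupp1 : SupportedOn A1 ↑I1) (hSupp2 : SupportedOn A2 ↑I2)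
    (ε : ℝ) (hε : 0 < ε) :
    (ℙ {ω | X ω ∈ A1 ∩ A2}).toReal -
        (ℙ {ω | (fun i => X ω i + ε) ∈ A1}).toReal *
          (ℙ {ω | (fun i => X ω i + ε) ∈ A2}).toReal ≤
      kNorm K I1 I2 / ε ^ 2 := by
  have hL : 0 ≤ ε⁻¹ := by positivity
  have hc {A : Set (Fin n → ℝ)} (hA : IncreasingEvent A) : Continuous (softIndicator A ε) :=
    (hA.monotone_softIndicator.lipschitzWith_of_add_const_le hL
      (softIndicator_add_le hε)).continuous
  have hcov := hX.cov_le hK (I := I1) (J := I2) hL softIndicator_nonneg softIndicator_le_one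
    hInc1.monotone_softIndicator (softIndicator_add_le hε) hSupp1.softIndicator_eq
    softIndicator_nonneg softIndicator_le_one
    hInc2.monotone_softIndicator (softIndicator_add_le hε) hSupp2.softIndicator_eq
  have hint : Integrable
      (fun ω => softIndicator A1 ε (X ω) * softIndicator A2 ε (X ω)) ℙ := by
    refine Integrable.of_bound ?_ 1 (ae_of_all _ fun ω => ?_)
    · exact (((hc hInc1).mul (hc hInc2)).measurable.comp_aemeasurable
        hX.aemeasurable).aestronglyMeasurable
    · rw [Real.norm_eq_abs, abs_of_nonneg
        (mul_nonneg (softIndicator_nonneg _) (softIndicator_nonneg _))]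
      exact mul_le_one₀ (softIndicator_le_one _) (softIndicator_nonneg _) (softIndicator_le_one _)
  have h12 : (ℙ {ω | X ω ∈ A1 ∩ A2}).toReal
      ≤ ∫ ω, softIndicator A1 ε (X ω) * softIndicator A2 ε (X ω) ∂ℙ :=
    toReal_measure_le_integral_of_one_le hint
      (fun ω => mul_nonneg (softIndicator_nonneg _) (softIndicator_nonneg _)) fun ω hω => by
        rw [softIndicator_eq_one hω.1, softIndicator_eq_one hω.2, mul_one]
  have hmean {A : Set (Fin n → ℝ)} (hA : IncreasingEvent A) :
      ∫ ω, softIndicator A ε (X ω) ∂ℙ ≤ (ℙ {ω | (fun i => X ω i + ε) ∈ A}).toReal :=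
    integral_le_toReal_measure_of_pos (fun ω => softIndicator_le_one _)
      fun ω hω => hA.mem_of_softIndicator_pos hε hω
  have hprod := mul_le_mul (hmean hInc1) (hmean hInc2)
    (integral_nonneg fun ω => softIndicator_nonneg _) ENNReal.toReal_nonneg
  rw [div_eq_mul_inv, ← inv_pow]
  linarith
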